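/- If (u,m) is a smooth solution of the MFG system, then u_x(t,x) ≥ 0 for all (t,x) ∈ [0,T]×[0,L], m_x(t,0) ≥ 0 for all t ∈ [0,T], and u_xx(t,L) ≤ 0 for all t ∈ [0,T]. -/

import Mathlib

open Set MeasureTheory intervalIntegral Function

noncomputable section

/-- Spatial derivative `u_x`. -/
def pdx (u : ℝ → ℝ → ℝ) (t x : ℝ) : ℝ := deriv (u t) x

/-- Second spatial derivative `u_xx`. -/
def pdxx (u : ℝ → ℝ → ℝ) (t x : ℝ) : ℝ := deriv (deriv (u t)) x

/-- Time derivative `u_t`. -/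
def pdt (u : ℝ → ℝ → ℝ) (t x : ℝ) : ℝ := deriv (fun s => u s x) t

/-- `η(t) = ∫₀^L m(t,x) dx`. -/
def mfgEta (L : ℝ) (m : ℝ → ℝ → ℝ) (t : ℝ) : ℝ := ∫ x in (0:ℝ)..L, m t x

/-- `f(t) = a(η(t)) + c(η(t)) p̄(t)`. -/
def mfgF (L ε : ℝ) (u m : ℝ → ℝ → ℝ) (t : ℝ) : ℝ :=
  2 / (2 + ε * mfgEta L m t)
    + (ε / (2 + ε * mfgEta L m t)) * ∫ x in (0:ℝ)..L, pdx u t x * m t x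

/-- `G(t,x) = (1/2)(f(t) − u_x(t,x))`. -/
def mfgG (L ε : ℝ) (u m : ℝ → ℝ → ℝ) (t x : ℝ) : ℝ :=
  (1/2) * (mfgF L ε u m t - pdx u t x)

/-- `H(t,x) = G(t,x)²`. -/
def mfgH (L ε : ℝ) (u m : ℝ → ℝ → ℝ) (t x : ℝ) : ℝ := (mfgG L ε u m t x)^2

/-- Standing assumptions on the data. -/
structure MFGData (T L σ r ε : ℝ) (uT m0 : ℝ → ℝ) : Prop where
  hT : 0 < T
  hL : 0 < L
  hσ : 0 < σ
  hr : 0 < r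
  hε : 0 ≤ ε
  uT_smooth : ContDiff ℝ 2 uT
  m0_smooth : ContDiff ℝ 2 m0
  uT_zero : uT 0 = 0
  uT_deriv_L : deriv uT L = 0
  uT_nonneg : ∀ x ∈ Icc (0:ℝ) L, 0 ≤ uT x
  uT_deriv_nonneg : ∀ x ∈ Icc (0:ℝ) L, 0 ≤ deriv uT x
  m0_zero : m0 0 = 0
  m0_L : m0 L = 0
  m0_deriv_L : deriv m0 L = 0
  m0_nonneg : ∀ x ∈ Icc (0:ℝ) L, 0 ≤ m0 x
  m0_mass : (∫ x in (0:ℝ)..L, m0 x) = 1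

/-- A smooth solution of the MFG system \eqref{main system}. -/
structure IsMFGSolution (T L σ r ε : ℝ) (uT m0 : ℝ → ℝ) (u m : ℝ → ℝ → ℝ) : Prop where
  u_smooth : ContDiff ℝ (⊤ : ℕ∞) (uncurry u)
  m_smooth : ContDiff ℝ (⊤ : ℕ∞) (uncurry m)
  hjb : ∀ t ∈ Ioo (0:ℝ) T, ∀ x ∈ Ioo (0:ℝ) L,
    pdt u t x + σ^2/2 * pdxx u t x - r * u t x + mfgH L ε u m t x = 0
  fp : ∀ t ∈ Ioo (0:ℝ) T, ∀ x ∈ Ioo (0:ℝ) L,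
    pdt m t x - σ^2/2 * pdxx m t x
      - deriv (fun y => mfgG L ε u m t y * m t y) x = 0
  m_init : ∀ x ∈ Icc (0:ℝ) L, m 0 x = m0 x
  u_term : ∀ x ∈ Icc (0:ℝ) L, u T x = uT x
  u_bdry : ∀ t ∈ Icc (0:ℝ) T, u t 0 = 0
  m_bdry : ∀ t ∈ Icc (0:ℝ) T, m t 0 = 0
  ux_bdry : ∀ t ∈ Icc (0:ℝ) T, pdx u t L = 0
  m_flux : ∀ t ∈ Icc (0:ℝ) T,
    σ^2/2 * pdx m t L + mfgG L ε u m t L * m t L = 0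

end

/-- A function whose right neighbours are not smaller has nonnegative derivative. -/
theorem deriv_nonneg_of_eventually_le_right {g : ℝ → ℝ} {t : ℝ} (hg : DifferentiableAt ℝ g t)
    (h : ∀ᶠ s in nhdsWithin t (Ioi t), g t ≤ g s) : 0 ≤ deriv g t := by
  have h1 := hg.hasDerivAt.hasDerivWithinAt (s := Ioi t)
  rw [hasDerivWithinAt_iff_tendsto_slope' (by simp)] at h1
  refine ge_of_tendsto h1 ?_
  filter_upwards [h, self_mem_nhdsWithin] with s hs hts
  rw [slope_def_field]
  exact div_nonneg (by linarith) (by have := mem_Ioi.1 hts; linarith)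

/-- A function whose left neighbours are not smaller has nonpositive derivative. -/
theorem deriv_nonpos_of_eventually_le_left {g : ℝ → ℝ} {t : ℝ} (hg : DifferentiableAt ℝ g t)
    (h : ∀ᶠ s in nhdsWithin t (Iio t), g t ≤ g s) : deriv g t ≤ 0 := by
  have h1 := hg.hasDerivAt.hasDerivWithinAt (s := Iio t)
  rw [hasDerivWithinAt_iff_tendsto_slope' (by simp)] at h1
  refine le_of_tendsto h1 ?_
  filter_upwards [h, self_mem_nhdsWithin] with s hs hts
  rw [slope_def_field]
  exact div_nonpos_of_nonneg_of_nonpos (by linarith) (by have := mem_Iio.1 hts; linarith)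

theorem IsMinOn.deriv_nonneg_of_mem_Ico {g : ℝ → ℝ} {a b t : ℝ} (hg : DifferentiableAt ℝ g t)
    (ht : t ∈ Ico a b) (h : IsMinOn g (Icc a b) t) : 0 ≤ deriv g t := by
  apply deriv_nonneg_of_eventually_le_right hg
  filter_upwards [Ioo_mem_nhdsGT ht.2] with s hs
  exact h ⟨ht.1.trans hs.1.le, hs.2.le⟩

theorem IsMinOn.deriv_nonpos_of_mem_Ioc {g : ℝ → ℝ} {a b t : ℝ} (hg : DifferentiableAt ℝ g t)
    (ht : t ∈ Ioc a b) (h : IsMinOn g (Icc a b) t) : deriv g t ≤ 0 := by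
  apply deriv_nonpos_of_eventually_le_left hg
  filter_upwards [Ioo_mem_nhdsLT ht.1] with s hs
  exact h ⟨hs.1.le, hs.2.le.trans ht.2⟩

/-- Second-order necessary condition at a critical minimum, endpoints included. -/
theorem IsMinOn.deriv_deriv_nonneg {g : ℝ → ℝ} {a b x : ℝ} (hab : a < b)
    (hg : Continuous g) (hg2 : Continuous (deriv (deriv g))) (hx : x ∈ Icc a b)
    (h0 : deriv g x = 0) (h : IsMinOn g (Icc a b) x) : 0 ≤ deriv (deriv g) x := by
  by_contra! hneg
  have hmax : IsLocalMax g x := isLocalMax_of_deriv_deriv_neg hneg h0 hg.continuousAt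
  have hev : ∀ᶠ y in nhds x, (∀ᶠ z in nhds y, g z ≤ g x) ∧ deriv (deriv g) y < 0 :=
    (eventually_eventually_nhds.2 hmax).and (hg2.continuousAt.eventually_lt_const hneg)
  have hcl : x ∈ closure (Ioo a b) := by rwa [closure_Ioo hab.ne]
  obtain ⟨y, ⟨hy1, hy2⟩, hyab⟩ := mem_closure_iff_nhds.1 hcl _ hev
  have hconst : g =ᶠ[nhds y] fun _ => g x := by
    filter_upwards [hy1, Ioo_mem_nhds hyab.1 hyab.2] with z hz hzab
    exact le_antisymm hz (h ⟨hzab.1.le, hzab.2.le⟩)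
  have := hconst.deriv.deriv_eq
  simp at this
  linarith

theorem hasDerivAt_right_fderiv {u : ℝ → ℝ → ℝ} (hu : ContDiff ℝ (⊤ : ℕ∞) (uncurry u)) (t x : ℝ) :
    HasDerivAt (u t) (fderiv ℝ (uncurry u) (t, x) (0, 1)) x := by
  have h1 : HasFDerivAt (uncurry u) (fderiv ℝ (uncurry u) (t, x)) (t, x) :=
    (hu.differentiable (by simp) _).hasFDerivAt
  have h2 : HasDerivAt (fun y : ℝ => (t, y)) ((0 : ℝ), (1 : ℝ)) x :=
    (hasDerivAt_const x t).prodMk (hasDerivAt_id x)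
  exact h1.comp_hasDerivAt x h2

theorem hasDerivAt_left_fderiv {u : ℝ → ℝ → ℝ} (hu : ContDiff ℝ (⊤ : ℕ∞) (uncurry u)) (t x : ℝ) :
    HasDerivAt (fun s => u s x) (fderiv ℝ (uncurry u) (t, x) (1, 0)) t := by
  have h1 : HasFDerivAt (uncurry u) (fderiv ℝ (uncurry u) (t, x)) (t, x) :=
    (hu.differentiable (by simp) _).hasFDerivAt
  have h2 : HasDerivAt (fun s : ℝ => (s, x)) ((1 : ℝ), (0 : ℝ)) t :=
    (hasDerivAt_id t).prodMk (hasDerivAt_const t x)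
  exact h1.comp_hasDerivAt t h2

theorem uncurry_pdx {u : ℝ → ℝ → ℝ} (hu : ContDiff ℝ (⊤ : ℕ∞) (uncurry u)) :
    uncurry (pdx u) = fun p => fderiv ℝ (uncurry u) p (0, 1) := by
  ext ⟨t, x⟩
  exact (hasDerivAt_right_fderiv hu t x).deriv

theorem uncurry_pdt {u : ℝ → ℝ → ℝ} (hu : ContDiff ℝ (⊤ : ℕ∞) (uncurry u)) :
    uncurry (pdt u) = fun p => fderiv ℝ (uncurry u) p (1, 0) := by
  ext ⟨t, x⟩
  exact (hasDerivAt_left_fderiv hu t x).deriv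

theorem contDiff_pdx {u : ℝ → ℝ → ℝ} (hu : ContDiff ℝ (⊤ : ℕ∞) (uncurry u)) :
    ContDiff ℝ (⊤ : ℕ∞) (uncurry (pdx u)) := by
  rw [uncurry_pdx hu]
  exact (hu.fderiv_right (m := ((⊤ : ℕ∞) : WithTop ℕ∞)) (by simp)).clm_apply contDiff_const

theorem contDiff_pdt {u : ℝ → ℝ → ℝ} (hu : ContDiff ℝ (⊤ : ℕ∞) (uncurry u)) :
    ContDiff ℝ (⊤ : ℕ∞) (uncurry (pdt u)) := by
  rw [uncurry_pdt hu]
  exact (hu.fderiv_right (m := ((⊤ : ℕ∞) : WithTop ℕ∞)) (by simp)).clm_apply contDiff_const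

theorem hasDerivAt_pdx {u : ℝ → ℝ → ℝ} (hu : ContDiff ℝ (⊤ : ℕ∞) (uncurry u)) (t x : ℝ) :
    HasDerivAt (u t) (pdx u t x) x :=
  (hasDerivAt_right_fderiv hu t x).differentiableAt.hasDerivAt

theorem hasDerivAt_pdt {u : ℝ → ℝ → ℝ} (hu : ContDiff ℝ (⊤ : ℕ∞) (uncurry u)) (t x : ℝ) :
    HasDerivAt (fun s => u s x) (pdt u t x) t :=
  (hasDerivAt_left_fderiv hu t x).differentiableAt.hasDerivAt

/-- Mixed partial derivatives commute. -/
theorem pdx_pdt_comm {u : ℝ → ℝ → ℝ} (hu : ContDiff ℝ (⊤ : ℕ∞) (uncurry u)) (t x : ℝ) :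
    pdx (pdt u) t x = pdt (pdx u) t x := by
  have hd : DifferentiableAt ℝ (fderiv ℝ (uncurry u)) (t, x) :=
    (hu.fderiv_right (m := 1) (WithTop.coe_le_coe.2 le_top)).differentiable (by simp) _
  have hsymm : IsSymmSndFDerivAt ℝ (uncurry u) (t, x) :=
    hu.contDiffAt.isSymmSndFDerivAt (by simp; exact WithTop.coe_le_coe.2 le_top)
  have h1 := (hasDerivAt_right_fderiv (contDiff_pdt hu) t x).deriv
  have h2 := (hasDerivAt_left_fderiv (contDiff_pdx hu) t x).deriv
  have e : ∀ v w : ℝ × ℝ, fderiv ℝ (fun p => fderiv ℝ (uncurry u) p v) (t, x) w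
      = fderiv ℝ (fderiv ℝ (uncurry u)) (t, x) w v := fun v w => by
    rw [fderiv_clm_apply hd (differentiableAt_const _)]
    simp
  rw [uncurry_pdt hu, e] at h1
  rw [uncurry_pdx hu, e] at h2
  change deriv _ _ = deriv _ _
  rw [h1, h2]
  exact hsymm _ _

/-- A weak inequality between continuous functions extends from an open rectangle to its closure. -/
theorem le_on_Icc_of_le_on_Ioo {F G : ℝ → ℝ → ℝ} {T L : ℝ} (hT : 0 < T) (hL : 0 < L)
    (hF : Continuous (uncurry F)) (hG : Continuous (uncurry G))
    (h : ∀ t ∈ Ioo (0:ℝ) T, ∀ x ∈ Ioo (0:ℝ) L, F t x ≤ G t x) :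
    ∀ t ∈ Icc (0:ℝ) T, ∀ x ∈ Icc (0:ℝ) L, F t x ≤ G t x := by
  intro t ht x hx
  have hcl : (t, x) ∈ closure (Ioo (0:ℝ) T ×ˢ Ioo (0:ℝ) L) := by
    rw [closure_prod_eq, closure_Ioo hT.ne, closure_Ioo hL.ne]
    exact ⟨ht, hx⟩
  exact le_on_closure (f := uncurry F) (g := uncurry G) (fun p hp => h p.1 hp.1 p.2 hp.2)
    hF.continuousOn hG.continuousOn hcl

/-- If a continuous function is negative somewhere on a rectangle, its minimum is negative. -/
theorem exists_neg_min {v : ℝ → ℝ → ℝ} {T L : ℝ} (hv : Continuous (uncurry v))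
    (h : ¬ ∀ t ∈ Icc (0:ℝ) T, ∀ x ∈ Icc (0:ℝ) L, 0 ≤ v t x) :
    ∃ t ∈ Icc (0:ℝ) T, ∃ x ∈ Icc (0:ℝ) L, v t x < 0 ∧ IsMinOn (v t) (Icc 0 L) x ∧
      IsMinOn (fun s => v s x) (Icc 0 T) t := by
  push Not at h
  obtain ⟨s, hs, y, hy, hsy⟩ := h
  obtain ⟨⟨t, x⟩, ⟨ht, hx⟩, hmin⟩ := (isCompact_Icc.prod isCompact_Icc).exists_isMinOn
    (s := Icc (0:ℝ) T ×ˢ Icc (0:ℝ) L) ⟨(s, y), hs, hy⟩ hv.continuousOn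
  refine ⟨t, ht, x, hx, ?_, fun z hz => ?_, fun z hz => ?_⟩
  · exact lt_of_le_of_lt (hmin (show (s, y) ∈ _ from ⟨hs, hy⟩)) hsy
  · exact hmin (show (t, z) ∈ _ from ⟨ht, hz⟩)
  · exact hmin (show (z, x) ∈ _ from ⟨hz, hx⟩)

/-- Minimum principle for the backward equation with a Neumann condition at `L`. -/
theorem nonneg_of_backward_supersolution {T L a r : ℝ} (hL : 0 < L) (ha : 0 < a)
    (hr : 0 < r) {u : ℝ → ℝ → ℝ} (hu : ContDiff ℝ (⊤ : ℕ∞) (uncurry u))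
    (hpde : ∀ t ∈ Icc (0:ℝ) T, ∀ x ∈ Icc (0:ℝ) L,
      pdt u t x + a * pdx (pdx u) t x - r * u t x ≤ 0)
    (hterm : ∀ x ∈ Icc (0:ℝ) L, 0 ≤ u T x) (h0 : ∀ t ∈ Icc (0:ℝ) T, 0 ≤ u t 0)
    (hN : ∀ t ∈ Icc (0:ℝ) T, pdx u t L = 0) :
    ∀ t ∈ Icc (0:ℝ) T, ∀ x ∈ Icc (0:ℝ) L, 0 ≤ u t x := by
  by_contra hcon
  obtain ⟨t, ht, x, hx, hneg, hminx, hmint⟩ := exists_neg_min hu.continuous hcon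
  have htT : t < T := lt_of_le_of_ne ht.2 (by rintro rfl; exact absurd (hterm x hx) hneg.not_ge)
  have hx0 : 0 < x := lt_of_le_of_ne hx.1 (by rintro rfl; exact absurd (h0 t ht) hneg.not_ge)
  have hut : 0 ≤ pdt u t x := hmint.deriv_nonneg_of_mem_Ico
    (hasDerivAt_pdt hu t x).differentiableAt ⟨ht.1, htT⟩
  have hux : pdx u t x = 0 := by
    rcases hx.2.eq_or_lt with rfl | hxL
    · exact hN t ht
    · exact (hminx.isLocalMin (Icc_mem_nhds hx0 hxL)).deriv_eq_zero
  have huxx : 0 ≤ pdx (pdx u) t x := hminx.deriv_deriv_nonneg hL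
    (hu.continuous.comp (Continuous.prodMk_right t))
    ((contDiff_pdx (contDiff_pdx hu)).continuous.comp (Continuous.prodMk_right t)) hx hux
  have := hpde t ht x hx
  nlinarith [mul_nonneg ha.le huxx, mul_pos hr (neg_pos.2 hneg)]

/-- Minimum principle for the backward equation with bounded drift and Dirichlet conditions. -/
theorem nonneg_of_backward_drift {T L a r M : ℝ} (hL : 0 < L) (ha : 0 < a)
    (hr : 0 < r) {w : ℝ → ℝ → ℝ} (hw : ContDiff ℝ (⊤ : ℕ∞) (uncurry w))
    (hpde : ∀ t ∈ Icc (0:ℝ) T, ∀ x ∈ Icc (0:ℝ) L,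
      |pdt w t x + a * pdx (pdx w) t x - r * w t x| ≤ M * |pdx w t x|)
    (hterm : ∀ x ∈ Icc (0:ℝ) L, 0 ≤ w T x) (h0 : ∀ t ∈ Icc (0:ℝ) T, 0 ≤ w t 0)
    (hD : ∀ t ∈ Icc (0:ℝ) T, 0 ≤ w t L) :
    ∀ t ∈ Icc (0:ℝ) T, ∀ x ∈ Icc (0:ℝ) L, 0 ≤ w t x := by
  by_contra hcon
  obtain ⟨t, ht, x, hx, hneg, hminx, hmint⟩ := exists_neg_min hw.continuous hcon
  have htT : t < T := lt_of_le_of_ne ht.2 (by rintro rfl; exact absurd (hterm x hx) hneg.not_ge)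
  have hx0 : 0 < x := lt_of_le_of_ne hx.1 (by rintro rfl; exact absurd (h0 t ht) hneg.not_ge)
  have hxL : x < L := lt_of_le_of_ne hx.2 (by rintro rfl; exact absurd (hD t ht) hneg.not_ge)
  have hwt : 0 ≤ pdt w t x := hmint.deriv_nonneg_of_mem_Ico
    (hasDerivAt_pdt hw t x).differentiableAt ⟨ht.1, htT⟩
  have hwx : pdx w t x = 0 := (hminx.isLocalMin (Icc_mem_nhds hx0 hxL)).deriv_eq_zero
  have hwxx : 0 ≤ pdx (pdx w) t x := hminx.deriv_deriv_nonneg hL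
    (hw.continuous.comp (Continuous.prodMk_right t))
    ((contDiff_pdx (contDiff_pdx hw)).continuous.comp (Continuous.prodMk_right t)) hx hwx
  have := (le_abs_self _).trans (hpde t ht x hx)
  rw [hwx, abs_zero, mul_zero] at this
  nlinarith [mul_nonneg ha.le hwxx, mul_pos hr (neg_pos.2 hneg)]

/-- Minimum principle for a forward equation with bounded coefficients and a Robin condition
at `L`. -/
theorem nonneg_of_forward_robin {T L a M B : ℝ} (hL : 0 < L) (ha : 0 < a) (hM : 0 ≤ M)
    {m b : ℝ → ℝ → ℝ} (hm : ContDiff ℝ (⊤ : ℕ∞) (uncurry m))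
    (hb : ∀ t ∈ Icc (0:ℝ) T, ∀ x ∈ Icc (0:ℝ) L, |b t x| ≤ B)
    (hpde : ∀ t ∈ Icc (0:ℝ) T, ∀ x ∈ Icc (0:ℝ) L,
      |pdt m t x - a * pdx (pdx m) t x + b t x * m t x| ≤ M * |pdx m t x|)
    (hinit : ∀ x ∈ Icc (0:ℝ) L, 0 ≤ m 0 x) (h0 : ∀ t ∈ Icc (0:ℝ) T, 0 ≤ m t 0)
    (hR : ∀ t ∈ Icc (0:ℝ) T, |a * pdx m t L| ≤ M * |m t L|) :
    ∀ t ∈ Icc (0:ℝ) T, ∀ x ∈ Icc (0:ℝ) L, 0 ≤ m t x := by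
  set κ : ℝ := (M + 1) / a with hκ
  have hκ0 : 0 ≤ κ := by positivity
  have haκ : a * κ = M + 1 := by rw [hκ]; field_simp
  set c : ℝ := a * κ ^ 2 + B + M * κ + 1 with hc
  set v : ℝ → ℝ → ℝ := fun t x => Real.exp (-c * t - κ * x) * m t x with hv
  have hpos : ∀ t x : ℝ, 0 < Real.exp (-c * t - κ * x) := fun t x => Real.exp_pos _
  have hvsmooth : ContDiff ℝ (⊤ : ℕ∞) (uncurry v) := by
    have : uncurry v = fun p : ℝ × ℝ => Real.exp (-c * p.1 - κ * p.2) * uncurry m p := rfl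
    rw [this]
    fun_prop
  have hEx : ∀ t x : ℝ, HasDerivAt (fun y => Real.exp (-c * t - κ * y))
      (Real.exp (-c * t - κ * x) * (-κ)) x := fun t x => by
    have h := ((hasDerivAt_id x).const_mul κ).const_sub (-c * t)
    simpa using h.exp
  have hEt : ∀ t x : ℝ, HasDerivAt (fun s => Real.exp (-c * s - κ * x))
      (Real.exp (-c * t - κ * x) * (-c)) t := fun t x => by
    have h := ((hasDerivAt_id t).const_mul (-c)).sub_const (κ * x)
    simpa using h.exp
  have hvx : ∀ t x, pdx v t x = Real.exp (-c * t - κ * x) * (pdx m t x - κ * m t x) :=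
    fun t x => by
    refine ((hEx t x).mul (hasDerivAt_pdx hm t x)).deriv.trans ?_
    ring
  have hvxx : ∀ t x, pdx (pdx v) t x = Real.exp (-c * t - κ * x) *
      (pdx (pdx m) t x - 2 * κ * pdx m t x + κ ^ 2 * m t x) := fun t x => by
    have e : pdx v t = fun x => Real.exp (-c * t - κ * x) * (pdx m t x - κ * m t x) :=
      funext (hvx t)
    change deriv (pdx v t) x = _
    rw [e]
    refine ((hEx t x).mul ((hasDerivAt_pdx (contDiff_pdx hm) t x).sub
      ((hasDerivAt_pdx hm t x).const_mul κ))).deriv.trans ?_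
    simp only [Pi.sub_apply]
    ring
  have hvt : ∀ t x, pdt v t x = Real.exp (-c * t - κ * x) * (pdt m t x - c * m t x) :=
    fun t x => by
    refine ((hEt t x).mul (hasDerivAt_pdt hm t x)).deriv.trans ?_
    ring
  by_contra hcon
  have hcon' : ¬ ∀ t ∈ Icc (0:ℝ) T, ∀ x ∈ Icc (0:ℝ) L, 0 ≤ v t x := fun h =>
    hcon fun t ht x hx => nonneg_of_mul_nonneg_right (h t ht x hx) (hpos t x)
  obtain ⟨t, ht, x, hx, hneg, hminx, hmint⟩ := exists_neg_min hvsmooth.continuous hcon'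
  have hmneg : m t x < 0 := by
    by_contra! h
    exact hneg.not_ge (mul_nonneg (hpos t x).le h)
  have ht0 : 0 < t := lt_of_le_of_ne ht.1 (by rintro rfl; exact hmneg.not_ge (hinit x hx))
  have hx0 : 0 < x := lt_of_le_of_ne hx.1 (by rintro rfl; exact hmneg.not_ge (h0 t ht))
  rcases hx.2.eq_or_lt with rfl | hxL
  · have h1 : pdx v t x ≤ 0 := hminx.deriv_nonpos_of_mem_Ioc
      (hasDerivAt_pdx hvsmooth t x).differentiableAt ⟨hx0, le_rfl⟩
    rw [hvx] at h1
    have h2 : pdx m t x - κ * m t x ≤ 0 := by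
      by_contra! h
      exact h1.not_gt (mul_pos (hpos t x) h)
    have h3 := (neg_abs_le _).trans' (neg_le_neg (hR t ht))
    rw [abs_of_neg hmneg] at h3
    have h4 := mul_nonneg ha.le (neg_nonneg.2 h2)
    have h5 : a * (κ * m t x) = (M + 1) * m t x := by rw [← haκ]; ring
    linarith
  · have h1 : pdx v t x = 0 := (hminx.isLocalMin (Icc_mem_nhds hx0 hxL)).deriv_eq_zero
    have h2 : 0 ≤ pdx (pdx v) t x := hminx.deriv_deriv_nonneg hL
      (hvsmooth.continuous.comp (Continuous.prodMk_right t))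
      ((contDiff_pdx (contDiff_pdx hvsmooth)).continuous.comp (Continuous.prodMk_right t)) hx h1
    have h3 : pdt v t x ≤ 0 := hmint.deriv_nonpos_of_mem_Ioc
      (hasDerivAt_pdt hvsmooth t x).differentiableAt ⟨ht0, ht.2⟩
    rw [hvx] at h1
    rw [hvxx] at h2
    rw [hvt] at h3
    have h1' : pdx m t x = κ * m t x := by
      have := (mul_eq_zero.1 h1).resolve_left (hpos t x).ne'
      linarith
    have h2' := nonneg_of_mul_nonneg_right h2 (hpos t x)
    have h3' : pdt m t x ≤ c * m t x := by
      by_contra! h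
      exact h3.not_gt (mul_pos (hpos t x) (by linarith))
    have h4 := (neg_abs_le _).trans' (neg_le_neg (hpde t ht x hx))
    rw [h1', abs_mul, abs_of_nonneg hκ0, abs_of_neg hmneg] at h4
    rw [h1'] at h2'
    have h5 := mul_nonneg ha.le h2'
    have h6 : b t x * m t x ≤ -B * m t x := by
      have := neg_le_of_abs_le (hb t ht x hx)
      nlinarith
    rw [hc] at h3'
    nlinarith

/-- The Fokker–Planck drift is bounded on the closed space interval, by the HJB equation alone. -/
theorem IsMFGSolution.exists_drift_bound {T L σ r ε : ℝ} {uT m0 : ℝ → ℝ} {u m : ℝ → ℝ → ℝ}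
    (hL : 0 < L) (hsol : IsMFGSolution T L σ r ε uT m0 u m) :
    ∃ M, 0 ≤ M ∧ ∀ t ∈ Ioo (0:ℝ) T, ∀ x ∈ Icc (0:ℝ) L, |mfgG L ε u m t x| ≤ M := by
  have hu := hsol.u_smooth
  have hux := contDiff_pdx hu
  have hK : Continuous fun p : ℝ × ℝ => uncurry (pdt u) p + σ ^ 2 / 2 * uncurry (pdx (pdx u)) p
      - r * uncurry u p :=
    ((contDiff_pdt hu).continuous.add (continuous_const.mul (contDiff_pdx hux).continuous)).sub
      (continuous_const.mul hu.continuous)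
  obtain ⟨C, hC⟩ := (isCompact_Icc.prod isCompact_Icc).exists_bound_of_continuousOn
    (s := Icc (0:ℝ) T ×ˢ Icc (0:ℝ) L) hK.continuousOn
  refine ⟨|C| + 1, by positivity, fun t ht => ?_⟩
  have hI : ∀ x ∈ Ioo (0:ℝ) L, |mfgG L ε u m t x| ≤ |C| + 1 := fun x hx => by
    have h1 := hsol.hjb t ht x hx
    have h2 : |pdt u t x + σ ^ 2 / 2 * pdxx u t x - r * u t x| ≤ C :=
      hC (t, x) ⟨Ioo_subset_Icc_self ht, Ioo_subset_Icc_self hx⟩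
    rw [mfgH] at h1
    apply abs_le_of_sq_le_sq _ (by positivity)
    nlinarith [neg_abs_le (pdt u t x + σ ^ 2 / 2 * pdxx u t x - r * u t x), le_abs_self C,
      abs_nonneg C]
  have hGc : Continuous (mfgG L ε u m t) :=
    continuous_const.mul (continuous_const.sub (hux.continuous.comp (Continuous.prodMk_right t)))
  intro x hx
  exact le_on_closure hI hGc.abs.continuousOn continuousOn_const
    (by rwa [closure_Ioo hL.ne])

/-- sign information: u_x ≥ 0 on [0,T]×[0,L], m_x(t,0) ≥ 0 and
u_xx(t,L) ≤ 0 for all t ∈ [0,T]. -/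
theorem mfg_sign_lemma (T L σ r ε : ℝ) (uT m0 : ℝ → ℝ)
    (hdata : MFGData T L σ r ε uT m0)
    (u m : ℝ → ℝ → ℝ) (hsol : IsMFGSolution T L σ r ε uT m0 u m) :
    (∀ t ∈ Icc (0:ℝ) T, ∀ x ∈ Icc (0:ℝ) L, 0 ≤ pdx u t x) ∧
    (∀ t ∈ Icc (0:ℝ) T, 0 ≤ pdx m t 0) ∧
    (∀ t ∈ Icc (0:ℝ) T, pdxx u t L ≤ 0) := by
  have hT := hdata.hT
  have hL := hdata.hL
  have ha : 0 < σ ^ 2 / 2 := by have := hdata.hσ; positivity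
  have hu := hsol.u_smooth
  have hm := hsol.m_smooth
  have hux := contDiff_pdx hu
  have huxx := contDiff_pdx hux
  have hmx := contDiff_pdx hm
  have h0L : (0:ℝ) ∈ Icc (0:ℝ) L := left_mem_Icc.2 hL.le
  have hLL : L ∈ Icc (0:ℝ) L := right_mem_Icc.2 hL.le
  obtain ⟨M, hM, hGM⟩ := hsol.exists_drift_bound hL
  have hGx : ∀ t x, HasDerivAt (mfgG L ε u m t) (-(1/2) * pdx (pdx u) t x) x := fun t x =>
    (((hasDerivAt_pdx hux t x).const_sub (mfgF L ε u m t)).const_mul (1/2)).congr_deriv (by ring)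
  have hu0 : ∀ t ∈ Icc (0:ℝ) T, ∀ x ∈ Icc (0:ℝ) L, 0 ≤ u t x := by
    refine nonneg_of_backward_supersolution hL ha hdata.hr hu ?_ ?_ ?_ hsol.ux_bdry
    · refine le_on_Icc_of_le_on_Ioo (G := fun _ _ => 0) hT hL ?_ continuous_const ?_
      · exact ((contDiff_pdt hu).continuous.add (continuous_const.mul huxx.continuous)).sub
          (continuous_const.mul hu.continuous)
      · intro t ht x hx
        have h1 := hsol.hjb t ht x hx
        have h2 : 0 ≤ mfgH L ε u m t x := sq_nonneg _
        change pdt u t x + σ ^ 2 / 2 * pdxx u t x - r * u t x ≤ 0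
        linarith
    · intro x hx
      rw [hsol.u_term x hx]
      exact hdata.uT_nonneg x hx
    · intro t ht
      exact (hsol.u_bdry t ht).ge
  have hux0 : ∀ t ∈ Icc (0:ℝ) T, ∀ x ∈ Icc (0:ℝ) L, 0 ≤ pdx u t x := by
    have hbd0 : ∀ t ∈ Icc (0:ℝ) T, 0 ≤ pdx u t 0 := fun t ht =>
      IsMinOn.deriv_nonneg_of_mem_Ico (hasDerivAt_pdx hu t 0).differentiableAt
        (left_mem_Ico.2 hL) fun x hx => by
          change u t 0 ≤ u t x
          rw [hsol.u_bdry t ht]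
          exact hu0 t ht x hx
    have hterm : ∀ x ∈ Icc (0:ℝ) L, 0 ≤ pdx u T x := by
      have hI : ∀ x ∈ Ioo (0:ℝ) L, 0 ≤ pdx u T x := fun x hx => by
        have he : u T =ᶠ[nhds x] uT := by
          filter_upwards [Ioo_mem_nhds hx.1 hx.2] with y hy
          exact hsol.u_term y (Ioo_subset_Icc_self hy)
        change 0 ≤ deriv (u T) x
        rw [he.deriv_eq]
        exact hdata.uT_deriv_nonneg x (Ioo_subset_Icc_self hx)
      intro x hx
      exact le_on_closure hI continuousOn_const
        (hux.continuous.comp (Continuous.prodMk_right T)).continuousOn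
        (by rwa [closure_Ioo hL.ne])
    refine nonneg_of_backward_drift (M := M) hL ha hdata.hr hux ?_ hterm hbd0
      fun t ht => (hsol.ux_bdry t ht).ge
    refine le_on_Icc_of_le_on_Ioo hT hL ?_ ?_ ?_
    · exact (((contDiff_pdt hux).continuous.add (continuous_const.mul
        (contDiff_pdx huxx).continuous)).sub (continuous_const.mul hux.continuous)).abs
    · exact continuous_const.mul huxx.continuous.abs
    · intro t ht x hx
      have hz : (fun y => pdt u t y + σ ^ 2 / 2 * pdx (pdx u) t y - r * u t y
          + mfgG L ε u m t y ^ 2) =ᶠ[nhds x] fun _ => 0 := by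
        filter_upwards [Ioo_mem_nhds hx.1 hx.2] with y hy
        exact hsol.hjb t ht y hy
      have hd := ((((hasDerivAt_pdx (contDiff_pdt hu) t x).add
        ((hasDerivAt_pdx huxx t x).const_mul (σ ^ 2 / 2))).sub
        ((hasDerivAt_pdx hu t x).const_mul r)).add ((hGx t x).pow 2)).unique
        ((hasDerivAt_const x (0:ℝ)).congr_of_eventuallyEq hz)
      rw [pdx_pdt_comm hu] at hd
      have he : pdt (pdx u) t x + σ ^ 2 / 2 * pdx (pdx (pdx u)) t x - r * pdx u t x
          = mfgG L ε u m t x * pdx (pdx u) t x := by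
        norm_num at hd
        linarith
      rw [he, abs_mul]
      exact mul_le_mul_of_nonneg_right (hGM t ht x (Ioo_subset_Icc_self hx)) (abs_nonneg _)
  have hm0 : ∀ t ∈ Icc (0:ℝ) T, ∀ x ∈ Icc (0:ℝ) L, 0 ≤ m t x := by
    obtain ⟨B, hB⟩ := (isCompact_Icc.prod isCompact_Icc).exists_bound_of_continuousOn
      (s := Icc (0:ℝ) T ×ˢ Icc (0:ℝ) L) (f := fun p => 1/2 * uncurry (pdx (pdx u)) p)
      (continuous_const.mul huxx.continuous).continuousOn
    refine nonneg_of_forward_robin (b := fun t x => 1/2 * pdx (pdx u) t x) hL ha hM hm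
      (fun t ht x hx => hB (t, x) ⟨ht, hx⟩) ?_ ?_ (fun t ht => (hsol.m_bdry t ht).ge) ?_
    · refine le_on_Icc_of_le_on_Ioo hT hL ?_ ?_ ?_
      · exact (((contDiff_pdt hm).continuous.sub (continuous_const.mul
          (contDiff_pdx hmx).continuous)).add
          ((continuous_const.mul huxx.continuous).mul hm.continuous)).abs
      · exact continuous_const.mul hmx.continuous.abs
      · intro t ht x hx
        have h1 := hsol.fp t ht x hx
        have h2 := ((hGx t x).mul (hasDerivAt_pdx hm t x)).deriv
        have he : pdt m t x - σ ^ 2 / 2 * pdx (pdx m) t x + 1/2 * pdx (pdx u) t x * m t x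
            = mfgG L ε u m t x * pdx m t x := by
          change deriv (fun y => mfgG L ε u m t y * m t y) x = _ at h2
          change pdt m t x - σ ^ 2 / 2 * pdx (pdx m) t x - _ = 0 at h1
          rw [h2] at h1
          linarith
        rw [he, abs_mul]
        exact mul_le_mul_of_nonneg_right (hGM t ht x (Ioo_subset_Icc_self hx)) (abs_nonneg _)
    · intro x hx
      rw [hsol.m_init x hx]
      exact hdata.m0_nonneg x hx
    · intro t ht
      have hI : ∀ t ∈ Ioo (0:ℝ) T, |σ ^ 2 / 2 * pdx m t L| ≤ M * |m t L| := fun t ht => by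
        have h1 := hsol.m_flux t (Ioo_subset_Icc_self ht)
        rw [eq_neg_of_add_eq_zero_left h1, abs_neg, abs_mul]
        exact mul_le_mul_of_nonneg_right (hGM t ht L hLL) (abs_nonneg _)
      exact le_on_closure hI
        (continuous_const.mul (hmx.continuous.comp (Continuous.prodMk_left L))).abs.continuousOn
        (continuous_const.mul (hm.continuous.comp (Continuous.prodMk_left L)).abs).continuousOn
        (by rwa [closure_Ioo hT.ne])
  refine ⟨hux0, fun t ht => ?_, fun t ht => ?_⟩
  · exact IsMinOn.deriv_nonneg_of_mem_Ico (hasDerivAt_pdx hm t 0).differentiableAt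
      (left_mem_Ico.2 hL) fun x hx => by
        change m t 0 ≤ m t x
        rw [hsol.m_bdry t ht]
        exact hm0 t ht x hx
  · exact IsMinOn.deriv_nonpos_of_mem_Ioc (hasDerivAt_pdx hux t L).differentiableAt
      (right_mem_Ioc.2 hL) fun x hx => by
        change pdx u t L ≤ pdx u t x
        rw [hsol.ux_bdry t ht]
        exact hux0 t ht x hx
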